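/- Let G be a weakly connected digraph with exactly one source SCC (α = 1) and β > 1 sink SCCs, and let e = (t, s) be an edge with s in the source SCC, t in a sink SCC, and such that there exists t' in a sink SCC different from that of t with s ⇝ t'. Then max{α', β'} = max{α, β} − 1 = β − 1, where α', β' are the numbers of source and sink SCCs of G + e. -/

import Mathlib

variable {V : Type*}

/-- Directed reachability: reflexive-transitive closure of the edge relation. -/
def Reach (E : V → V → Prop) : V → V → Prop :=
  Relation.ReflTransGen E

/-- Mutual reachability. -/
def Mut (E : V → V → Prop) (u v : V) : Prop :=
  Reach E u v ∧ Reach E v u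

/-- A strongly connected component: an equivalence class of mutual reachability. -/
def IsSCC (E : V → V → Prop) (S : Set V) : Prop :=
  ∃ v, S = {w | Mut E v w}

/-- No edge enters `S` from outside `S`. -/
def NoIn (E : V → V → Prop) (S : Set V) : Prop :=
  ∀ a b, E a b → b ∈ S → a ∈ S

/-- No edge leaves `S`. -/
def NoOut (E : V → V → Prop) (S : Set V) : Prop :=
  ∀ a b, E a b → a ∈ S → b ∈ S

/-- Some edge leaves `S`. -/
def SomeOut (E : V → V → Prop) (S : Set V) : Prop :=
  ∃ a b, E a b ∧ a ∈ S ∧ b ∉ S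

/-- Some edge enters `S` from outside. -/
def SomeIn (E : V → V → Prop) (S : Set V) : Prop :=
  ∃ a b, E a b ∧ a ∉ S ∧ b ∈ S

/-- Weak connectivity: the underlying undirected graph is connected. -/
def WeaklyConn (E : V → V → Prop) : Prop :=
  ∀ u v : V, Relation.ReflTransGen (fun a b => E a b ∨ E b a) u v

/-- The source SCCs: SCCs with some outgoing edge but no incoming edge. -/
def SourceSCCs (E : V → V → Prop) : Set (Set V) :=
  {S | IsSCC E S ∧ NoIn E S ∧ SomeOut E S}

/-- The sink (target) SCCs: SCCs with some incoming edge but no outgoing edge. -/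
def SinkSCCs (E : V → V → Prop) : Set (Set V) :=
  {S | IsSCC E S ∧ NoOut E S ∧ SomeIn E S}

theorem reach_stay (E : V → V → Prop) (S : Set V) (h : NoOut E S) {u v : V}
    (hu : u ∈ S) (hr : Reach E u v) : v ∈ S := by
  induction hr with
  | refl => exact hu
  | tail _ hbc ih => exact h _ _ hbc ih

theorem reach_stay_in (E : V → V → Prop) (S : Set V) (h : NoIn E S) {u v : V}
    (hv : v ∈ S) (hr : Reach E u v) : u ∈ S := by
  induction hr using Relation.ReflTransGen.head_induction_on with
  | refl => exact hv
  | head hab _ ih => exact h _ _ hab ih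

theorem reach_sub (E E' : V → V → Prop) (S : Set V) (h : NoOut E S)
    (hE : ∀ a b, a ∈ S → E a b → E' a b) {u v : V}
    (hu : u ∈ S) (hr : Reach E u v) : Reach E' u v := by
  have : v ∈ S ∧ Reach E' u v := by
    induction hr with
    | refl => exact ⟨hu, Relation.ReflTransGen.refl⟩
    | tail _ hbc ih => exact ⟨h _ _ hbc ih.1, ih.2.tail (hE _ _ ih.1 hbc)⟩
  exact this.2

theorem src_reach [Fintype V] (E : V → V → Prop) (hW : WeaklyConn E)
    (hNS : ¬ ∀ u v : V, u ≠ v → Reach E u v ∧ Reach E v u)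
    (S : Set V) (hS : SourceSCCs E = {S}) (s : V) (hs : s ∈ S) (x : V) : Reach E s x := by
  obtain ⟨u, hu, hmin⟩ := Set.exists_min_image {u | Reach E u x}
    (fun u => {w | Reach E w u}.ncard) (Set.toFinite _) ⟨x, Relation.ReflTransGen.refl⟩
  have hC : {w | Mut E u w} ∈ SourceSCCs E := by
    have hin : NoIn E {w | Mut E u w} := by
      intro a b hab hb
      have hau : Reach E a u := Relation.ReflTransGen.head hab hb.2
      have hsub : {w | Reach E w a} ⊆ {w | Reach E w u} := fun w hw =>
        Relation.ReflTransGen.trans hw hau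
      have heq := Set.eq_of_subset_of_ncard_le hsub
        (hmin a (Relation.ReflTransGen.trans hau hu)) (Set.toFinite _)
      have : u ∈ {w | Reach E w a} := by
        rw [heq]; exact Relation.ReflTransGen.refl
      exact ⟨this, hau⟩
    refine ⟨⟨u, rfl⟩, hin, ?_⟩
    by_contra hno
    have hout : NoOut E {w | Mut E u w} := by
      intro a b hab ha
      by_contra hb
      exact hno ⟨a, b, hab, ha, hb⟩
    have hall : ∀ v, Mut E u v := by
      intro v
      refine reach_stay (fun a b => E a b ∨ E b a) {w | Mut E u w} ?_ (u := u)
        ⟨Relation.ReflTransGen.refl, Relation.ReflTransGen.refl⟩ (hW u v)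
      rintro a b (h | h) ha
      · exact hout _ _ h ha
      · exact hin _ _ h ha
    exact hNS fun a b _ => ⟨Relation.ReflTransGen.trans (hall a).2 (hall b).1,
      Relation.ReflTransGen.trans (hall b).2 (hall a).1⟩
  rw [hS, Set.mem_singleton_iff] at hC
  rw [← hC] at hs
  exact Relation.ReflTransGen.trans hs.2 hu

/-- α = 1, β > 1, and a tight edge (t, s): then
max{α', β'} = max{α, β} − 1 = β − 1 for G + (t,s). -/
theorem stmt_13 [Fintype V] (E : V → V → Prop)
    (hW : WeaklyConn E)
    (hNS : ¬ ∀ u v : V, u ≠ v → Reach E u v ∧ Reach E v u)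
    (α β : ℕ)
    (hα : α = (SourceSCCs E).ncard) (hβ : β = (SinkSCCs E).ncard)
    (hα1 : α = 1) (hβ1 : 1 < β)
    (s t : V)
    (hs : ∃ S ∈ SourceSCCs E, s ∈ S)
    (ht : ∃ T ∈ SinkSCCs E, t ∈ T)
    (ht' : ∃ t' : V, (∃ T' ∈ SinkSCCs E, t' ∈ T') ∧ ¬ Mut E t' t ∧ Reach E s t') :
    max ((SourceSCCs (fun a b => E a b ∨ (a = t ∧ b = s))).ncard)
        ((SinkSCCs (fun a b => E a b ∨ (a = t ∧ b = s))).ncard)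
      = max α β - 1 ∧ max α β - 1 = β - 1 := by
  subst hα hβ
  obtain ⟨S, hSS⟩ := Set.ncard_eq_one.mp hα1
  have hsS : s ∈ S := by
    obtain ⟨S', h1, h2⟩ := hs
    rw [hSS, Set.mem_singleton_iff] at h1
    exact h1 ▸ h2
  have hr := src_reach E hW hNS S hSS s hsS
  obtain ⟨T, hT, htT⟩ := ht
  have hTm : ∀ w ∈ T, Mut E t w := by
    obtain ⟨⟨v, rfl⟩, _⟩ := hT
    intro w hw
    exact ⟨Relation.ReflTransGen.trans htT.2 hw.1, Relation.ReflTransGen.trans hw.2 htT.1⟩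
  generalize hE' : (fun a b => E a b ∨ (a = t ∧ b = s)) = E'
  have hmono : ∀ a b, E a b → E' a b := by subst hE'; exact fun a b h => Or.inl h
  have hinv : ∀ a b, E' a b → E a b ∨ (a = t ∧ b = s) := by subst hE'; exact fun a b h => h
  have hts : E' t s := by subst hE'; exact Or.inr ⟨rfl, rfl⟩
  clear hE'
  have hmr : ∀ {a b}, Reach E a b → Reach E' a b := fun h => Relation.ReflTransGen.mono hmono _ _ h
  have h1 : (SourceSCCs E').ncard ≤ 1 := by
    rw [Set.ncard_le_one_iff (Set.toFinite _)]
    have key : ∀ A ∈ SourceSCCs E', A = {w | Mut E' s w} := by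
      rintro A ⟨⟨v, rfl⟩, hin, _⟩
      have hsv : s ∈ {w | Mut E' v w} := reach_stay_in E' _ hin (v := v)
        ⟨Relation.ReflTransGen.refl, Relation.ReflTransGen.refl⟩ (hmr (hr v))
      ext w
      exact ⟨fun hw => ⟨Relation.ReflTransGen.trans hsv.2 hw.1,
          Relation.ReflTransGen.trans hw.2 hsv.1⟩,
        fun hw => ⟨Relation.ReflTransGen.trans hsv.1 hw.1,
          Relation.ReflTransGen.trans hw.2 hsv.2⟩⟩
    intro A B hA hB
    rw [key A hA, key B hB]
  have h2 : SinkSCCs E' = SinkSCCs E \ {T} := by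
    ext A
    constructor
    · rintro ⟨⟨v, hv⟩, hout, a, b, hab, ha, hb⟩
      have hs' : s ∉ A := fun h => ha (reach_stay E' A hout h (hmr (hr a)))
      have ht' : t ∉ A := fun h => hs' (hout _ _ hts h)
      have hvA : v ∈ A := by
        rw [hv]; exact ⟨Relation.ReflTransGen.refl, Relation.ReflTransGen.refl⟩
      have hsub : ∀ a b, a ∈ A → E' a b → E a b := by
        intro a b ha hab
        rcases hinv a b hab with h | ⟨rfl, _⟩
        · exact h
        · exact absurd ha ht'
      refine ⟨⟨⟨v, ?_⟩, fun a b h => hout a b (hmono a b h), a, b, ?_, ha, hb⟩, ?_⟩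
      · ext w
        constructor
        · intro hw
          have hw' : Mut E' v w := by rw [hv] at hw; exact hw
          exact ⟨reach_sub E' E A hout hsub hvA hw'.1, reach_sub E' E A hout hsub hw hw'.2⟩
        · intro hw
          rw [hv]
          exact ⟨hmr hw.1, hmr hw.2⟩
      · rcases hinv a b hab with h | ⟨_, rfl⟩
        · exact h
        · exact absurd hb hs'
      · rintro rfl
        exact ht' htT
    · rintro ⟨⟨⟨v, hv⟩, hout, a, b, hab, ha, hb⟩, hne⟩
      have ht' : t ∉ A := by
        intro h
        apply hne
        have hvt : Mut E v t := by rw [hv] at h; exact h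
        ext w
        constructor
        · intro hw
          rw [hv] at hw
          exact reach_stay E T hT.2.1 htT (Relation.ReflTransGen.trans hvt.2 hw.1)
        · intro hw
          exact reach_stay E A hout h (hTm w hw).1
      have hout' : NoOut E' A := by
        intro a b hab ha
        rcases hinv a b hab with h | ⟨rfl, _⟩
        · exact hout _ _ h ha
        · exact absurd ha ht'
      have hvA : v ∈ A := by
        rw [hv]; exact ⟨Relation.ReflTransGen.refl, Relation.ReflTransGen.refl⟩
      refine ⟨⟨v, ?_⟩, hout', a, b, hmono _ _ hab, ha, hb⟩
      ext w
      constructor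
      · intro hw
        rw [hv] at hw
        exact ⟨hmr hw.1, hmr hw.2⟩
      · intro hw
        exact reach_stay E' A hout' hvA hw.1
  have h3 : (SinkSCCs E').ncard = (SinkSCCs E).ncard - 1 := by
    rw [h2, Set.ncard_sdiff_singleton_of_mem hT]
  omega
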